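/- There is no automaton with exactly four internal states over the nine PM observables that obeys both the contextuality sequences Q'_context and the compatibility sequences Q'_compat and in which some state contradicts exactly three of the six contexts. -/

import Mathlib

/-- The nine observables of the Peres-Mermin square, indexed by (row, column). -/
abbrev PMObs := Fin 3 × Fin 3

/-- The six contexts of the PM square: `(0, i)` is row `i`, `(1, j)` is column `j`. -/
abbrev PMCtx := Fin 2 × Fin 3

/-- The three observables of a context, enumerated by `Fin 3`. -/
def ctxObs (K : PMCtx) (m : Fin 3) : PMObs :=
  if K.1 = 0 then (K.2, m) else (m, K.2)

/-- The required product of a context: `-1` for the third column, `+1` otherwise. -/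
def pmSign (K : PMCtx) : ℤ := if K = (1, 2) then -1 else 1

/-- Two PM observables are compatible iff they share a row or a column. -/
def Compatible (x y : PMObs) : Prop := x.1 = y.1 ∨ x.2 = y.2

/-- A deterministic Mealy automaton with states `S` over observables `Obs`,
outputting values in `{+1, -1}` (as integers). -/
structure Mealy (S : Type) (Obs : Type) where
  f : S → Obs → ℤ
  δ : S → Obs → S
  sign : ∀ s x, f s x = 1 ∨ f s x = -1

/-- The state reached after processing a list of inputs. -/
def Mealy.run {S Obs : Type} (M : Mealy S Obs) : S → List Obs → S
  | s, [] => s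
  | s, x :: xs => M.run (M.δ s x) xs

/-- The output produced at position `i` of input list `L`, started in state `s`. -/
def Mealy.out {S Obs : Type} (M : Mealy S Obs) (s : S) (L : List Obs)
    (i : Fin L.length) : ℤ :=
  M.f (M.run s (L.take i.1)) (L.get i)

/-- The automaton obeys the contextuality sequences Q'_context. -/
def ObeysContext {S : Type} (M : Mealy S PMObs) : Prop :=
  ∀ (s : S) (K : PMCtx) (L : List PMObs), (∀ x ∈ L, ∃ m, x = ctxObs K m) →
    (∀ i j : Fin L.length, L.get i = L.get j → M.out s L i = M.out s L j) ∧
    (∀ i j k : Fin L.length,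
      L.get i = ctxObs K 0 → L.get j = ctxObs K 1 → L.get k = ctxObs K 2 →
      M.out s L i * M.out s L j * M.out s L k = pmSign K)

/-- The automaton obeys the compatibility sequences Q'_compat. -/
def ObeysCompat {S : Type} (M : Mealy S PMObs) : Prop :=
  ∀ (s : S) (Y : PMObs) (L : List PMObs), (∀ x ∈ L, Compatible x Y) →
    M.f s Y = M.f (M.run (M.δ s Y) L) Y


/-- Context `K` is contradicted at state `s`. -/
def Contradicted {S : Type} (M : Mealy S PMObs) (s : S) (K : PMCtx) : Prop :=
  M.f s (ctxObs K 0) * M.f s (ctxObs K 1) * M.f s (ctxObs K 2) ≠ pmSign K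

/-! ### Lock systems -/

section LockSystem

variable {S : Type} {c : PMCtx → Bool} {L D : S → PMObs → Bool}

/-- In state `s` every locked observable compatible with `x`, and `x` itself, is still locked
and has the same value in state `t`. -/
def Moves (L D : S → PMObs → Bool) (s : S) (x : PMObs) (t : S) : Prop :=
  ∀ y, Compatible x y → (y = x ∨ L s y = true) → L t y = true ∧ D t y = D s y

/-- Whether `K` is contradicted in state `s`, where `c` tells which contexts are contradicted
in a reference state and `D` which values differ from the reference state. -/
def contra (c : PMCtx → Bool) (D : S → PMObs → Bool) (s : S) (K : PMCtx) : Bool :=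
  c K ^^ (D s (ctxObs K 0) ^^ D s (ctxObs K 1) ^^ D s (ctxObs K 2))

/-- The combinatorial content of the contextuality and compatibility sequences: `L s x` says that
the value of `x` in state `s` persists under all measurements compatible with `x`. -/
structure LockSystem (c : PMCtx → Bool) (L D : S → PMObs → Bool) : Prop where
  lock : ∀ s K p q, p ≠ q → L s (ctxObs K p) = true → L s (ctxObs K q) = true →
    contra c D s K = false
  move : ∀ s x, L s x = false → ∃ t, t ≠ s ∧ Moves L D s x t

lemma compatible_ctxObs (K : PMCtx) (p q : Fin 3) :
    Compatible (ctxObs K p) (ctxObs K q) := by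
  unfold Compatible ctxObs
  split_ifs <;> simp

lemma xor_fin_three (g : Fin 3 → Bool) (p q r : Fin 3) (hpq : p ≠ q) (hpr : p ≠ r) (hqr : q ≠ r) :
    (g 0 ^^ g 1 ^^ g 2) = (g p ^^ g q ^^ g r) := by
  revert g p q r
  decide

lemma LockSystem.two_transfers (h : LockSystem c L D) {s t : S} {K : PMCtx} {p q r : Fin 3}
    (hpq : p ≠ q) (hpr : p ≠ r) (hqr : q ≠ r) (hs : contra c D s K = true)
    (hp : Moves L D s (ctxObs K p) t)
    (hq : Moves L D s (ctxObs K q) t ∨ L s (ctxObs K q) = true) :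
    contra c D t K = false ∧ D t (ctxObs K r) ≠ D s (ctxObs K r) ∧
      ¬ Moves L D s (ctxObs K r) t ∧ L s (ctxObs K r) = false := by
  have hp' := hp _ (compatible_ctxObs K p p) (Or.inl rfl)
  have hq' : L t (ctxObs K q) = true ∧ D t (ctxObs K q) = D s (ctxObs K q) := by
    rcases hq with hq | hq
    · exact hq _ (compatible_ctxObs K q q) (Or.inl rfl)
    · exact hp _ (compatible_ctxObs K p q) (Or.inr hq)
  have ht := h.lock t K p q hpq hp'.1 hq'.1
  have hne : D t (ctxObs K r) ≠ D s (ctxObs K r) := by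
    intro hr
    have e1 := xor_fin_three (fun m => D s (ctxObs K m)) p q r hpq hpr hqr
    have e2 := xor_fin_three (fun m => D t (ctxObs K m)) p q r hpq hpr hqr
    simp only [hp'.2, hq'.2, hr] at e2
    have : contra c D t K = contra c D s K := by
      unfold contra
      rw [e2.trans e1.symm]
    simp_all
  refine ⟨ht, hne, fun hr => hne (hr _ (compatible_ctxObs K r r) (Or.inl rfl)).2, ?_⟩
  by_contra hr
  exact hne (hp _ (compatible_ctxObs K p r) (Or.inr (by simpa using hr))).2

lemma LockSystem.exists_two_targets (h : LockSystem c L D) {s : S} {K : PMCtx}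
    (hs : contra c D s K = true) :
    ∃ p q : Fin 3, ∃ t u : S, p ≠ q ∧ L s (ctxObs K p) = false ∧ L s (ctxObs K q) = false ∧
      t ≠ s ∧ u ≠ s ∧ t ≠ u ∧ Moves L D s (ctxObs K p) t ∧ Moves L D s (ctxObs K q) u := by
  have hl : ∀ p q, p ≠ q → L s (ctxObs K p) = true → L s (ctxObs K q) = false := by
    intro p q hpq hp
    by_contra hq
    have := h.lock s K p q hpq hp (by simpa using hq)
    simp_all
  obtain ⟨p, q, r, hpq, hpr, hqr, hp, hq⟩ : ∃ p q r : Fin 3, p ≠ q ∧ p ≠ r ∧ q ≠ r ∧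
      L s (ctxObs K p) = false ∧ L s (ctxObs K q) = false := by
    cases h0 : L s (ctxObs K 0)
    · cases h1 : L s (ctxObs K 1)
      · exact ⟨0, 1, 2, by decide, by decide, by decide, h0, h1⟩
      · exact ⟨0, 2, 1, by decide, by decide, by decide, h0, hl 1 2 (by decide) h1⟩
    · exact ⟨1, 2, 0, by decide, by decide, by decide, hl 0 1 (by decide) h0,
        hl 0 2 (by decide) h0⟩
  obtain ⟨t, hts, ht⟩ := h.move s _ hp
  obtain ⟨u, hus, hu⟩ := h.move s _ hq
  by_cases htu : t = u
  · subst htu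
    obtain ⟨-, -, hr, hrL⟩ := h.two_transfers hpq hpr hqr hs ht (Or.inl hu)
    obtain ⟨v, hvs, hv⟩ := h.move s _ hrL
    exact ⟨p, r, t, v, hpr, hp, hrL, hts, hvs, fun e => hr (e ▸ hv), ht, hv⟩
  · exact ⟨p, q, t, u, hpq, hp, hq, hts, hus, htu, ht, hu⟩

lemma Moves.relabel {T : Type} {σ : T → S} {e : PMObs → PMObs}
    (he : ∀ x y, Compatible x y → Compatible (e x) (e y)) {s t : T} {x : PMObs}
    (h : Moves L D (σ s) (e x) (σ t)) :
    Moves (fun s x => L (σ s) (e x)) (fun s x => D (σ s) (e x)) s x t :=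
  fun y hxy hy => h (e y) (he x y hxy) (hy.imp (congrArg e) id)

/-- Relabelling of the states and of the square. -/
lemma LockSystem.relabel (h : LockSystem c L D) {T : Type} (σ : T ≃ S) (e : PMObs → PMObs)
    (E : PMCtx → PMCtx) (he : ∀ x y, Compatible x y → Compatible (e x) (e y))
    (hE : ∀ K, ∃ ρ : Equiv.Perm (Fin 3), ∀ m, e (ctxObs K m) = ctxObs (E K) (ρ m)) :
    LockSystem (c ∘ E) (fun s x => L (σ s) (e x)) (fun s x => D (σ s) (e x)) := by
  constructor
  · intro s K p q hpq hp hq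
    obtain ⟨ρ, hρ⟩ := hE K
    simp only [hρ] at hp hq
    have := h.lock (σ s) (E K) (ρ p) (ρ q) (ρ.injective.ne hpq) hp hq
    rw [← this]
    simp only [contra, hρ, Function.comp]
    rw [xor_fin_three (fun m => D (σ s) (ctxObs (E K) m)) (ρ 0) (ρ 1) (ρ 2)
      (ρ.injective.ne (by decide)) (ρ.injective.ne (by decide)) (ρ.injective.ne (by decide))]
  · intro s x hx
    obtain ⟨t, hts, ht⟩ := h.move (σ s) (e x) hx
    exact ⟨σ.symm t, fun hh => hts (by simp [← hh]),
      Moves.relabel he ((σ.apply_symm_apply t).symm ▸ ht)⟩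

/-- Some symmetry of the square takes two observables of the first row to two given
observables of a context. -/
lemma exists_symmetry (K : PMCtx) (p q : Fin 3) (hpq : p ≠ q) :
    ∃ (e : PMObs → PMObs) (E : PMCtx → PMCtx), Function.Bijective E ∧
      (∀ x y, Compatible x y → Compatible (e x) (e y)) ∧
      (∀ K, ∃ ρ : Equiv.Perm (Fin 3), ∀ m, e (ctxObs K m) = ctxObs (E K) (ρ m)) ∧
      e (0, 0) = ctxObs K p ∧ e (0, 1) = ctxObs K q ∧ E (0, 0) = K := by
  obtain ⟨ε, i⟩ := K
  obtain ⟨τ, hp, hq⟩ : ∃ τ : Equiv.Perm (Fin 3), τ 0 = p ∧ τ 1 = q := by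
    revert p q
    decide
  have hσ : Equiv.swap 0 i 0 = i := Equiv.swap_apply_left 0 i
  generalize Equiv.swap 0 i = σ at hσ
  refine ⟨fun x => if ε = 0 then (σ x.1, τ x.2) else (τ x.2, σ x.1),
    fun K => if K.1 = 0 then (ε, σ K.2) else (ε + 1, τ K.2), ?_, ?_, ?_, ?_⟩
  · rw [← Finite.injective_iff_bijective]
    rintro ⟨a, b⟩ ⟨a', b'⟩
    fin_cases a <;> fin_cases a' <;> simp
  · rintro x y (h | h) <;> unfold Compatible <;> split_ifs <;> simp [h]
  · rintro ⟨a, b⟩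
    fin_cases a
    · refine ⟨τ, fun m => ?_⟩
      fin_cases ε <;> simp [ctxObs]
    · refine ⟨σ, fun m => ?_⟩
      fin_cases ε <;> simp [ctxObs]
  · subst hp hq
    fin_cases ε <;> simp [ctxObs, hσ]

end LockSystem

lemma exists_equiv_fin_four {S : Type} [Fintype S] (hS : Fintype.card S = 4) {s t u : S}
    (hts : t ≠ s) (hus : u ≠ s) (htu : t ≠ u) :
    ∃ σ : Fin 4 ≃ S, σ 0 = s ∧ σ 1 = t ∧ σ 2 = u := by
  classical
  obtain ⟨w, hw⟩ : ∃ w, w ∉ ({s, t, u} : Finset S) := by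
    by_contra! hcon
    have h1 : (Finset.univ : Finset S) ⊆ {s, t, u} := fun w _ => hcon w
    have h2 := Finset.card_le_card h1
    rw [Finset.card_univ, hS] at h2
    exact absurd (h2.trans Finset.card_le_three) (by decide)
  simp only [Finset.mem_insert, Finset.mem_singleton, not_or] at hw
  have hinj : Function.Injective ![s, t, u, w] := by
    intro i j hij
    fin_cases i <;> fin_cases j <;> simp_all
  have hbij : Function.Bijective ![s, t, u, w] :=
    (Fintype.bijective_iff_injective_and_card _).2 ⟨hinj, by simp [hS]⟩
  exact ⟨Equiv.ofBijective _ hbij, rfl, rfl, rfl⟩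

/-! ### Lock systems of automata -/

section Automaton

variable {S : Type} {M : Mealy S PMObs}

/-- No sequence of measurements compatible with `y` changes the value of `y`. -/
def Locked (M : Mealy S PMObs) (s : S) (y : PMObs) : Prop :=
  ∀ l : List PMObs, (∀ x ∈ l, Compatible x y) → M.f (M.run s l) y = M.f s y

lemma Locked.step {s : S} {x y : PMObs} (h : Locked M s y) (hxy : Compatible x y) :
    Locked M (M.δ s x) y ∧ M.f (M.δ s x) y = M.f s y := by
  have h1 : M.f (M.δ s x) y = M.f s y := h [x] (by simpa using hxy)
  refine ⟨fun l hl => ?_, h1⟩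
  rw [h1]
  exact h (x :: l) (List.forall_mem_cons.2 ⟨hxy, hl⟩)

lemma ObeysCompat.locked_step (h : ObeysCompat M) (s : S) (y : PMObs) :
    Locked M (M.δ s y) y ∧ M.f (M.δ s y) y = M.f s y := by
  have h1 : M.f s y = M.f (M.δ s y) y := h s y [] (by simp)
  exact ⟨fun l hl => by rw [← h1]; exact (h s y l hl).symm, h1.symm⟩

lemma ObeysContext.not_contradicted (h : ObeysContext M) {s : S} {K : PMCtx}
    (hl : ∀ m, Locked M s (ctxObs K m)) : ¬ Contradicted M s K := by
  unfold Contradicted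
  rw [not_not]
  have h1 := (h s K [ctxObs K 0, ctxObs K 1, ctxObs K 2] (by simp)).2
    ⟨0, by simp⟩ ⟨1, by simp⟩ ⟨2, by simp⟩ rfl rfl rfl
  have e1 := hl 1 [ctxObs K 0] (by simpa using compatible_ctxObs K 0 1)
  have e2 := hl 2 [ctxObs K 0, ctxObs K 1]
    (by simpa using ⟨compatible_ctxObs K 0 2, compatible_ctxObs K 1 2⟩)
  rw [← e1, ← e2]
  exact h1

open Classical in
lemma contra_eq_contradicted (M : Mealy S PMObs) (s₀ s : S) (K : PMCtx) :
    contra (fun K => decide (Contradicted M s₀ K)) (fun s x => decide (M.f s x ≠ M.f s₀ x)) s K =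
      decide (Contradicted M s K) := by
  unfold contra Contradicted
  have hK : pmSign K = 1 ∨ pmSign K = -1 := by
    unfold pmSign
    split_ifs <;> simp
  rcases hK with hK | hK <;>
  rcases M.sign s (ctxObs K 0) with h0 | h0 <;> rcases M.sign s (ctxObs K 1) with h1 | h1 <;>
  rcases M.sign s (ctxObs K 2) with h2 | h2 <;> rcases M.sign s₀ (ctxObs K 0) with h3 | h3 <;>
  rcases M.sign s₀ (ctxObs K 1) with h4 | h4 <;> rcases M.sign s₀ (ctxObs K 2) with h5 | h5 <;>
  simp [h0, h1, h2, h3, h4, h5, hK]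

open Classical in
lemma lockSystem_of_obeys (hctx : ObeysContext M) (hcompat : ObeysCompat M) (s₀ : S) :
    LockSystem (fun K => decide (Contradicted M s₀ K)) (fun s x => decide (Locked M s x))
      (fun s x => decide (M.f s x ≠ M.f s₀ x)) := by
  have step : ∀ s x y, Compatible x y → (y = x ∨ Locked M s y) →
      Locked M (M.δ s x) y ∧ M.f (M.δ s x) y = M.f s y := by
    rintro s x y hxy (rfl | hy)
    · exact hcompat.locked_step s y
    · exact hy.step hxy
  constructor
  · intro s K p q hpq hp hq
    rw [contra_eq_contradicted, decide_eq_false_iff_not]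
    obtain ⟨r, hr⟩ : ∃ r : Fin 3, ∀ m, m = p ∨ m = q ∨ m = r := by
      clear hp hq
      revert p q
      decide
    have key : ∀ m, Locked M (M.δ s (ctxObs K r)) (ctxObs K m) ∧
        M.f (M.δ s (ctxObs K r)) (ctxObs K m) = M.f s (ctxObs K m) := by
      intro m
      refine step _ _ _ (compatible_ctxObs K r m) ?_
      rcases hr m with rfl | rfl | rfl
      · exact Or.inr (by simpa using hp)
      · exact Or.inr (by simpa using hq)
      · exact Or.inl rfl
    have := hctx.not_contradicted fun m => (key m).1
    simpa only [Contradicted, (key _).2] using this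
  · intro s x hx
    refine ⟨M.δ s x, fun e => ?_, fun y hxy hy => ?_⟩
    · have := (hcompat.locked_step s x).1
      rw [e] at this
      simp [this] at hx
    · have := step s x y hxy (hy.imp_right (by simp))
      simp [this.1, this.2]

end Automaton

/-! ### Checking refutations by unit propagation and case splits -/

section Refutation

variable {V : Type} {code : V → ℕ} {val : V → Bool}

/-- The position of a literal in the bit mask of falsified literals. -/
def litBit (code : V → ℕ) (l : V × Bool) : ℕ := 2 * code l.1 + l.2.toNat

/-- Extend the mask `F` of falsified literals by `l`. -/
def falsify (code : V → ℕ) (F : ℕ) (l : V × Bool) : ℕ := F ||| 1 <<< litBit code l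

/-- Unit propagation, visiting every clause once; the result is `none` if there is a conflict. -/
def propagate (code : V → ℕ) : List (List (V × Bool)) → ℕ → Option ℕ
  | [], F => some F
  | cl :: cls, F =>
    match cl.filter fun l => !F.testBit (litBit code l) with
    | [] => none
    | [l] => propagate code cls (falsify code F (l.1, !l.2))
    | _ => propagate code cls F

/-- Replay a refutation. An entry `n < N` is a case split on the variable `decode n`, and an entry
`n ≥ N` is a unit propagation with the clauses `group (n - N)`. After a conflict the replay
continues with the most recent open branch, which is stored in the second mask argument. -/
def refute (code : V → ℕ) (decode : ℕ → V) (N : ℕ) (group : ℕ → List (List (V × Bool))) :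
    List ℕ → ℕ → List ℕ → Bool
  | [], _, _ => false
  | n :: ns, F, pending =>
    if n < N then
      refute code decode N group ns (falsify code F (decode n, false))
        (falsify code F (decode n, true) :: pending)
    else
      match propagate code (group (n - N)) F with
      | some F' => refute code decode N group ns F' pending
      | none =>
        match pending with
        | [] => true
        | G :: pending' => refute code decode N group ns G pending'

/-- The clause `cl` is true under the valuation `val`. -/
def Holds (val : V → Bool) (cl : List (V × Bool)) : Prop := ∃ l ∈ cl, val l.1 = l.2

lemma holds_append {cl cl' : List (V × Bool)} :
    Holds val (cl ++ cl') ↔ Holds val cl ∨ Holds val cl' := by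
  simp only [Holds, List.mem_append, or_and_right, exists_or]

/-- All literals in the mask `F` are false under the valuation `val`. -/
def MaskFalse (code : V → ℕ) (val : V → Bool) (F : ℕ) : Prop :=
  ∀ l, F.testBit (litBit code l) = true → val l.1 ≠ l.2

lemma litBit_injective (hcode : Function.Injective code) :
    Function.Injective (litBit code) := by
  rintro ⟨v, a⟩ ⟨w, b⟩ h
  simp only [litBit] at h
  have hv : code v = code w := by cases a <;> cases b <;> simp at h <;> omega
  have hb : a = b := by cases a <;> cases b <;> simp at h ⊢ <;> omega
  rw [hcode hv, hb]

lemma MaskFalse.falsify (hcode : Function.Injective code) {F : ℕ} (hF : MaskFalse code val F)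
    {l : V × Bool} (hl : val l.1 ≠ l.2) : MaskFalse code val (falsify code F l) := by
  intro k hk
  rw [_root_.falsify, Nat.testBit_or, Bool.or_eq_true, Nat.one_shiftLeft,
    Nat.testBit_two_pow, decide_eq_true_iff] at hk
  rcases hk with hk | hk
  · exact hF k hk
  · rwa [← litBit_injective hcode hk]

lemma exists_propagate_eq_some (hcode : Function.Injective code)
    {cls : List (List (V × Bool))} (hcls : ∀ cl ∈ cls, Holds val cl) {F : ℕ}
    (hF : MaskFalse code val F) :
    ∃ F', propagate code cls F = some F' ∧ MaskFalse code val F' := by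
  induction cls generalizing F with
  | nil => exact ⟨F, rfl, hF⟩
  | cons cl cls ih =>
    rw [List.forall_mem_cons] at hcls
    obtain ⟨⟨l, hl, hval⟩, hcls⟩ := hcls
    have hmem : l ∈ cl.filter fun l => !F.testBit (litBit code l) := by
      rw [List.mem_filter]
      refine ⟨hl, ?_⟩
      by_contra hb
      exact hF l (by simpa using hb) hval
    unfold propagate
    split
    · simp_all
    · rename_i k hk
      rw [hk, List.mem_singleton] at hmem
      subst hmem
      exact ih hcls (hF.falsify hcode (by simp [hval]))
    · exact ih hcls hF

lemma not_maskFalse_of_refute (hcode : Function.Injective code) {decode : ℕ → V} {N : ℕ}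
    {group : ℕ → List (List (V × Bool))} (hgroup : ∀ g, ∀ cl ∈ group g, Holds val cl)
    {ns : List ℕ} {F : ℕ} {pending : List ℕ}
    (h : refute code decode N group ns F pending = true) :
    ∀ G ∈ F :: pending, ¬ MaskFalse code val G := by
  induction ns generalizing F pending with
  | nil => simp [refute] at h
  | cons n ns ih =>
    unfold refute at h
    split at h
    · have := ih h
      simp only [List.forall_mem_cons] at this ⊢
      refine ⟨fun hF => ?_, this.2.2⟩
      cases hv : val (decode n)
      · exact this.2.1 (hF.falsify hcode (by simp [hv]))
      · exact this.1 (hF.falsify hcode (by simp [hv]))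
    · split at h
      · rename_i F' hF'
        have := ih h
        rw [List.forall_mem_cons] at this ⊢
        refine ⟨fun hF => ?_, this.2⟩
        obtain ⟨F'', h1, h2⟩ := exists_propagate_eq_some hcode (hgroup (n - N)) hF
        rw [hF', Option.some_inj] at h1
        exact this.1 (h1 ▸ h2)
      · rename_i hnone
        have hF : ¬ MaskFalse code val F := by
          intro hF
          obtain ⟨F', h1, -⟩ := exists_propagate_eq_some hcode (hgroup (n - N)) hF
          simp [hnone] at h1
        rw [List.forall_mem_cons]
        refine ⟨hF, ?_⟩
        split at h
        · simp
        · exact ih h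

/-- The clauses saying that the exclusive or of `vs` is `b`. -/
def xorClauses : List V → Bool → List (List (V × Bool))
  | [], b => if b then [[]] else []
  | v :: vs, b =>
    (xorClauses vs b).map ((v, true) :: ·) ++ (xorClauses vs !b).map ((v, false) :: ·)

lemma holds_of_mem_xorClauses {vs : List V} {b : Bool}
    (h : vs.foldr (fun v a => val v ^^ a) false = b) :
    ∀ cl ∈ xorClauses vs b, Holds val cl := by
  induction vs generalizing b with
  | nil =>
    subst h
    simp [xorClauses]
  | cons v vs ih =>
    rw [List.foldr_cons] at h
    intro cl hcl
    simp only [xorClauses, List.mem_append, List.mem_map] at hcl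
    rcases hcl with ⟨cl, hcl, rfl⟩ | ⟨cl, hcl, rfl⟩
    · cases hv : val v
      · obtain ⟨l, hl, hval⟩ := ih (by simpa [hv] using h) cl hcl
        exact ⟨l, List.mem_cons_of_mem _ hl, hval⟩
      · exact ⟨(v, true), List.mem_cons_self, hv⟩
    · cases hv : val v
      · exact ⟨(v, false), List.mem_cons_self, hv⟩
      · obtain ⟨l, hl, hval⟩ := ih (by simp [← h, hv]) cl hcl
        exact ⟨l, List.mem_cons_of_mem _ hl, hval⟩

end Refutation

/-! ### Lock systems with four states -/

section FourStates

/-- The propositional variables describing a lock system with four states. -/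
inductive PMVar
  | lock (s : Fin 4) (x : PMObs)
  | diff (s : Fin 4) (x : PMObs)
  | contradicted (s : Fin 4) (K : PMCtx)
  | move (s : Fin 4) (x : PMObs) (t : Fin 4)

namespace PMVar

/-- An injective numbering of the variables by the numbers below `240`. -/
def code : PMVar → ℕ
  | lock s x => 9 * s + (3 * x.1 + x.2)
  | diff s x => 36 + 9 * s + (3 * x.1 + x.2)
  | contradicted s K => 72 + 6 * s + (3 * K.1 + K.2)
  | move s x t => 96 + 36 * t + 9 * s + (3 * x.1 + x.2)

/-- The state with number `n` modulo `4`. -/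
def stateOfNat (n : ℕ) : Fin 4 := Fin.ofNat 4 n

/-- The observable with number `n` modulo `9`. -/
def obsOfNat (n : ℕ) : PMObs := (Fin.ofNat 3 (n / 3), Fin.ofNat 3 n)

/-- The context with number `n` modulo `6`. -/
def ctxOfNat (n : ℕ) : PMCtx := (Fin.ofNat 2 (n / 3), Fin.ofNat 3 n)

/-- The variable with a given number. -/
def decode (n : ℕ) : PMVar :=
  if n < 36 then lock (stateOfNat (n / 9)) (obsOfNat n)
  else if n < 72 then diff (stateOfNat ((n - 36) / 9)) (obsOfNat (n - 36))
  else if n < 96 then contradicted (stateOfNat ((n - 72) / 6)) (ctxOfNat (n - 72))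
  else move (stateOfNat ((n - 96) / 9)) (obsOfNat (n - 96)) (stateOfNat ((n - 96) / 36))

lemma code_injective : Function.Injective code := by
  intro v w h
  cases v <;> cases w <;> simp only [code] at h <;>
    simp only [lock.injEq, diff.injEq, contradicted.injEq, move.injEq, Prod.ext_iff, Fin.ext_iff,
      reduceCtorEq] <;> omega

open Classical in
/-- The values of the variables in a lock system. -/
noncomputable def value (c : PMCtx → Bool) (L D : Fin 4 → PMObs → Bool) : PMVar → Bool
  | lock s x => L s x
  | diff s x => D s x
  | contradicted s K => contra c D s K
  | move s x t => decide (Moves L D s x t)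

end PMVar

open PMVar

/-- All observables. -/
def allObs : List PMObs := (List.range 9).map obsOfNat

/-- All contexts. -/
def allCtx : List PMCtx := (List.range 6).map ctxOfNat

/-- An observable that is not locked moves to another state. -/
def targetClauses (s : Fin 4) (x : PMObs) : List (List (PMVar × Bool)) :=
  [(lock s x, true) ::
    ((List.finRange 4).filter fun t => t ≠ s).map fun t => (move s x t, true)]

/-- The definition of `Moves`. -/
def moveClauses (s : Fin 4) (x : PMObs) (t : Fin 4) : List (List (PMVar × Bool)) :=
  (allObs.filter fun y => x.1 = y.1 ∨ x.2 = y.2).flatMap fun y =>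
    let pre := (move s x t, false) :: if y = x then [] else [(lock s y, false)]
    [pre ++ [(lock t y, true)], pre ++ [(diff s y, false), (diff t y, true)],
      pre ++ [(diff s y, true), (diff t y, false)]]

/-- Two locked observables exclude a contradiction, together with the definition of `contra`. -/
def ctxClauses (s : Fin 4) (K : PMCtx) : List (List (PMVar × Bool)) :=
  ([(0, 1), (0, 2), (1, 2)].map fun p : Fin 3 × Fin 3 =>
    [(contradicted s K, false), (lock s (ctxObs K p.1), false), (lock s (ctxObs K p.2), false)]) ++
  xorClauses [contradicted 0 K, contradicted s K, diff s (ctxObs K 0), diff s (ctxObs K 1),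
    diff s (ctxObs K 2)] false

/-- The number of contradicted contexts is odd. -/
def parityClauses (s : Fin 4) : List (List (PMVar × Bool)) :=
  xorClauses (allCtx.map (contradicted s)) true

/-- The six orderings of the observables of a context. -/
def orderings : List (Fin 3 × Fin 3 × Fin 3) :=
  [(0, 1, 2), (0, 2, 1), (1, 0, 2), (1, 2, 0), (2, 0, 1), (2, 1, 0)]

/-- The content of `LockSystem.two_transfers`. -/
def transferClauses (s : Fin 4) (K : PMCtx) (t : Fin 4) : List (List (PMVar × Bool)) :=
  orderings.flatMap fun o =>
    let p := ctxObs K o.1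
    let q := ctxObs K o.2.1
    let r := ctxObs K o.2.2
    [move s q t, lock s q].flatMap fun a =>
      let pre := [(contradicted s K, false), (move s p t, false), (a, false)]
      [pre ++ [(contradicted t K, false)], pre ++ [(move s r t, false)], pre ++ [(lock s r, false)],
        pre ++ [(diff s r, false), (diff t r, false)],
        pre ++ [(diff s r, true), (diff t r, true)]]

/-- The situation in the initial state. -/
def initialClauses : List (List (PMVar × Bool)) :=
  [[(move 0 (0, 0) 1, true)], [(move 0 (0, 1) 2, true)], [(lock 0 (0, 0), false)],
    [(lock 0 (0, 1), false)], [(contradicted 0 (0, 0), true)]] ++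
  (allObs.map fun x => [(diff 0 x, false)]) ++
  (allCtx.sublistsLen 4).map fun T => T.map fun K => (contradicted 0 K, true)

/-- A numbering of the groups of clauses. -/
def clauseGroup (g : ℕ) : List (List (PMVar × Bool)) :=
  if g < 36 then targetClauses (stateOfNat (g / 9)) (obsOfNat g)
  else if g < 180 then
    moveClauses (stateOfNat ((g - 36) / 9)) (obsOfNat (g - 36)) (stateOfNat ((g - 36) / 36))
  else if g < 204 then ctxClauses (stateOfNat ((g - 180) / 6)) (ctxOfNat (g - 180))
  else if g < 208 then parityClauses (stateOfNat (g - 204))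
  else if g < 304 then
    transferClauses (stateOfNat ((g - 208) / 6)) (ctxOfNat (g - 208))
      (stateOfNat ((g - 208) / 24))
  else initialClauses

/-- A refutation of the clauses, found by computer search. -/
def refutation : List ℕ :=
  [544, 286, 294, 303, 304, 312, 349, 287, 288, 291, 296, 298, 301, 54, 330, 358, 359, 360, 363,
    84, 432, 496, 258, 305, 377, 402, 438, 532, 260, 306, 309, 332, 341, 342, 345, 362, 365,
    378, 381, 396, 398, 399, 401, 426, 252, 255, 269, 270, 273, 289, 290, 292, 293, 308, 311,
    344, 347, 380, 383, 429, 441, 254, 257, 272, 275, 427, 428, 431, 439, 440, 443, 445, 447,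
    530, 430, 253, 256, 506, 432, 152, 332, 426, 81, 429, 252, 255, 529, 78, 426, 250, 251, 526,
    27, 305, 306, 309, 20, 63, 340, 341, 342, 345, 394, 395, 396, 399, 250, 251, 252, 255, 289,
    292, 93, 441, 270, 273, 517, 90, 438, 268, 269, 376, 377, 438, 47, 290, 293, 312, 335, 338,
    362, 365, 426, 299, 302, 221, 401, 438, 440, 443, 308, 376, 380, 268, 307, 343, 379, 271,
    442, 447, 439, 272, 344, 401, 257, 428, 431, 218, 398, 438, 439, 443, 376, 268, 307, 310,
    343, 346, 379, 382, 271, 274, 440, 442, 447, 254, 427, 445, 430, 319, 334, 337, 28, 25, 336,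
    436, 26, 434, 437, 220, 530, 253, 361, 433, 446, 535, 435, 258, 264, 300, 312, 400, 402,
    423, 441, 256, 364, 506, 253, 49, 397, 506, 406, 262, 333, 405, 407, 263, 433, 446, 435,
    258, 261, 297, 312, 397, 402, 423, 441, 397, 506, 349, 406, 262, 297, 333, 405, 261, 433,
    435, 446, 266, 364, 410, 440, 442, 443, 447, 256, 308, 344, 380, 400, 530, 253, 272, 361,
    433, 437, 439, 270, 378, 434, 435, 446, 265, 349, 355, 364, 247, 256, 391, 400, 409, 506,
    530, 253, 268, 376, 397, 400, 406, 409, 253, 256, 262, 265, 361, 364, 433, 434, 435, 436,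
    437, 446, 426, 334, 337, 361, 364, 220, 400, 438, 440, 442, 307, 377, 379, 269, 308, 344,
    380, 272, 443, 447, 439, 271, 343, 400, 256, 428, 430, 217, 397, 438, 439, 442, 377, 269,
    308, 311, 344, 347, 380, 383, 272, 275, 440, 443, 447, 253, 427, 445, 431, 335, 338, 344,
    347, 65, 377, 438, 269, 308, 311, 376, 380, 383, 268, 272, 275, 307, 310, 343, 346, 379,
    382, 443, 271, 274, 439, 440, 442, 447, 438, 25, 436, 30, 22, 201, 381, 433, 434, 435, 446,
    507, 437, 381, 383, 401, 257, 275, 293, 311, 459, 531, 254, 273, 28, 307, 310, 343, 346,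
    230, 410, 440, 442, 443, 447, 439, 271, 379, 407, 410, 515, 263, 272, 299, 308, 379, 421,
    439, 227, 407, 439, 442, 443, 447, 440, 274, 382, 407, 516, 266, 275, 302, 311, 382, 422,
    440, 221, 401, 440, 442, 443, 447, 439, 271, 388, 515, 272, 308, 316, 421, 439, 515, 352,
    379, 244, 349, 53, 293, 257, 365, 434, 437, 507, 299, 263, 333, 433, 446, 535, 435, 258,
    261, 297, 312, 402, 423, 437, 441, 459, 254, 398, 459, 182, 362, 433, 437, 507, 302, 266,
    300, 336, 434, 446, 535, 264, 435, 254, 398, 439, 442, 443, 447, 531, 311, 440, 274, 275,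
    516, 268, 376, 297, 300, 333, 336, 185, 365, 434, 435, 437, 446, 507, 433, 261, 351, 405,
    533, 263, 299, 315, 365, 376, 421, 425, 431, 459, 533, 254, 387, 398, 427, 243, 312, 203,
    383, 434, 435, 437, 446, 433, 261, 362, 380, 383, 398, 407, 254, 263, 272, 290, 299, 308,
    405, 421, 433, 218, 398, 439, 443, 531, 257, 293, 531, 311, 275, 310, 346, 440, 447, 518,
    274, 182, 362, 433, 435, 437, 446, 434, 264, 354, 408, 534, 266, 302, 318, 362, 376, 422,
    425, 431, 459, 534, 257, 390, 401, 428, 246, 312, 254, 290, 425, 431, 459, 257, 401, 440,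
    443, 308, 32, 307, 343, 439, 447, 518, 271, 272, 380, 433, 434, 435, 437, 446, 262, 349,
    352, 362, 406, 439, 442, 290, 308, 380, 254, 272, 398, 443, 447, 531, 440, 273, 516, 275,
    311, 316, 349, 398, 459, 244, 257, 365, 388, 398, 406, 430, 436, 270, 378, 398, 406, 408,
    435, 262, 300, 336, 433, 264, 434, 446, 507, 254, 290, 425, 431, 437, 459, 257, 378, 380,
    401, 443, 272, 308, 265, 349, 355, 365, 409, 442, 293, 307, 311, 343, 379, 381, 383, 257,
    271, 273, 275, 401, 440, 443, 447, 531, 439, 270, 378, 436, 515, 272, 308, 319, 349, 401,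
    459, 247, 254, 362, 391, 401, 409, 430, 436, 376, 377, 378, 381, 402, 258, 297, 300, 333,
    336, 405, 408, 261, 264, 435, 93, 441, 270, 273, 493, 90, 438, 268, 269, 490, 122, 302, 312,
    422, 425, 426, 334, 337, 229, 409, 438, 440, 442, 307, 341, 343, 269, 308, 344, 380, 272,
    443, 447, 439, 271, 379, 409, 265, 302, 434, 436, 226, 406, 438, 439, 442, 341, 269, 308,
    311, 344, 347, 380, 383, 272, 275, 440, 443, 447, 262, 433, 446, 465, 353, 48, 429, 435,
    335, 263, 407, 439, 441, 443, 345, 273, 310, 346, 382, 274, 440, 442, 447, 429, 435, 544,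
    335, 424, 433, 500, 263, 407, 388, 389, 244, 473, 245, 157, 337, 426, 428, 430, 472, 289,
    299, 335, 338, 65, 407, 410, 263, 266, 337, 433, 434, 437, 446, 488, 262, 361, 406, 439,
    442, 310, 382, 14, 431, 445, 427, 252, 253, 527, 341, 347, 269, 311, 383, 443, 447, 275,
    440, 273, 274, 492, 395, 438, 251, 290, 362, 397, 398, 254, 431, 445, 427, 253, 337, 361,
    88, 436, 265, 349, 364, 379, 409, 438, 440, 442, 536, 262, 292, 307, 334, 407, 410, 426,
    427, 430, 472, 299, 335, 338, 263, 266, 334, 409, 17, 431, 445, 428, 255, 256, 528, 341,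
    344, 269, 308, 380, 443, 447, 272, 439, 270, 271, 491, 23, 433, 437, 446, 434, 265, 409,
    438, 534, 266, 338, 394, 426, 428, 431, 250, 289, 361, 397, 253, 427, 430, 445, 362, 380,
    47, 312, 335, 426, 299, 263, 407, 438, 439, 443, 311, 340, 347, 379, 383, 268, 275, 307,
    310, 343, 346, 382, 271, 274, 440, 442, 447, 426, 334, 65, 341, 438, 269, 308, 311, 340,
    344, 347, 383, 268, 272, 275, 307, 310, 343, 346, 379, 443, 271, 439, 442, 447, 440, 274,
    382, 433, 434, 437, 446, 438, 406, 409, 262, 265, 433, 434, 446, 437, 365, 383, 34, 227,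
    407, 439, 442, 443, 447, 440, 273, 390, 492, 275, 311, 354, 422, 440, 492, 318, 345, 246,
    312, 35, 440, 10, 289, 292, 361, 364, 158, 338, 428, 430, 431, 445, 489, 263, 299, 312, 427,
    489, 253, 290, 527, 254, 266, 410, 443, 31, 442, 447, 439, 270, 387, 491, 272, 308, 351,
    421, 439, 491, 315, 342, 243, 312, 397, 253, 396, 400, 430, 252, 256, 427, 80, 428, 255,
    312, 318, 528, 257, 293, 354, 528, 246, 390, 445, 489, 263, 299, 312, 431, 537, 308, 344,
    272, 307, 343, 379, 271, 250, 394, 442, 307, 341, 343, 379, 269, 271, 443, 447, 439, 270,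
    387, 491, 272, 308, 351, 421, 439, 491, 315, 342, 243, 312, 410, 266, 338, 398, 428, 431,
    489, 263, 299, 312, 489, 290, 254, 289, 361, 427, 445, 530, 253, 430, 410, 266, 338, 394,
    397, 428, 431, 250, 289, 361, 430, 445, 253, 427, 252, 312, 315, 527, 254, 290, 351, 527,
    243, 387, 260, 349, 404, 438, 307, 308, 310, 311, 342, 345, 380, 383, 394, 395, 396, 399,
    250, 251, 252, 255, 289, 290, 292, 293, 362, 365, 47, 344, 347, 398, 401, 254, 257, 272,
    275, 427, 428, 431, 443, 445, 430, 343, 346, 181, 506, 256, 400, 440, 441, 442, 447, 439,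
    270, 271, 515, 253, 397, 439, 441, 442, 447, 440, 273, 274, 516, 426, 361, 364, 397, 400,
    253, 256, 427, 428, 430, 445, 431, 254, 257, 398, 401, 439, 440, 441, 442, 443, 447, 394,
    395, 396, 399, 402, 250, 251, 252, 255, 258, 289, 292, 297, 300, 333, 336, 404, 405, 408,
    260, 261, 264, 435, 47, 290, 293, 312, 335, 338, 362, 365, 299, 302, 26, 434, 437, 23, 433,
    446, 436, 361, 364, 154, 334, 427, 430, 431, 445, 428, 256, 257, 528, 262, 536, 265, 337,
    428, 430, 431, 445, 427, 253, 254, 527, 263, 407, 398, 401, 254, 257, 361, 427, 428, 431,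
    445, 430, 253, 334, 530, 256, 364, 436, 446, 533, 262, 266, 410, 398, 401, 254, 257, 364,
    427, 428, 431, 445, 430, 256, 337, 530, 253, 361, 433, 436, 437, 446, 534, 265, 426, 334,
    337, 361, 364, 86, 434, 265, 349, 355, 409, 534, 397, 400, 253, 256, 427, 428, 430, 445,
    431, 338, 266, 302, 319, 534, 247, 391, 23, 433, 437, 446, 436, 262, 265, 536, 353, 362,
    380, 25, 436, 89, 437, 356, 365, 158, 338, 428, 430, 431, 445, 489, 427, 253, 316, 397, 406,
    527, 254, 262, 290, 338, 352, 421, 427, 465, 527, 263, 388, 397, 407, 244, 349, 82, 430,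
    253, 256, 530, 14, 427, 431, 445, 428, 256, 319, 528, 257, 293, 352, 355, 422, 425, 428,
    528, 391, 400, 247, 316, 388, 244, 421, 424, 444, 544, 317, 335, 344, 59, 299, 263, 407,
    537, 266, 302, 389, 422, 245, 315, 316, 351, 352, 387, 388, 243, 244, 421, 423, 424, 544,
    465, 266, 410, 440, 443, 537, 263, 299, 308, 316, 320, 352, 388, 392, 421, 425, 443, 244,
    248, 272, 306, 307, 342, 343, 354, 355, 378, 379, 390, 391, 270, 271, 439, 441, 442, 447,
    438, 397, 400, 253, 256, 427, 428, 445, 431, 318, 319, 246, 247, 422, 423, 424, 544, 446,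
    433, 262, 349, 352, 406, 533, 397, 400, 253, 256, 427, 428, 430, 445, 431, 335, 263, 299,
    316, 533, 244, 388, 265, 349, 355, 409, 397, 400, 253, 256, 293, 365, 427, 428, 430, 445,
    431, 257, 320, 531, 254, 290, 356, 425, 431, 531, 392, 401, 248, 319, 391, 247, 496, 29,
    308, 311, 84, 432, 484, 260, 359, 360, 363, 375, 380, 383, 404, 438, 532, 258, 330, 339,
    395, 396, 399, 426, 251, 252, 255, 267, 289, 290, 292, 293, 306, 309, 342, 344, 345, 347,
    362, 365, 378, 381, 398, 401, 429, 254, 257, 270, 272, 273, 275, 427, 428, 431, 439, 440,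
    441, 443, 445, 447, 530, 430, 253, 256, 506, 432, 65, 386, 242, 314, 339, 347, 358, 362,
    365, 394, 398, 401, 426, 250, 289, 290, 292, 293, 334, 337, 361, 364, 254, 257, 431, 220,
    400, 438, 440, 442, 443, 307, 375, 379, 267, 306, 342, 378, 270, 441, 447, 439, 271, 343,
    400, 256, 428, 430, 217, 397, 438, 439, 442, 443, 375, 267, 306, 309, 342, 345, 378, 381,
    270, 273, 440, 441, 447, 253, 427, 445, 429, 312, 318, 342, 345, 306, 309, 33, 310, 346, 35,
    440, 443, 219, 399, 438, 441, 529, 252, 48, 360, 529, 378, 270, 307, 343, 379, 271, 439,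
    442, 447, 360, 529, 378, 270, 307, 343, 379, 271, 439, 442, 447, 255, 505, 252, 396, 438,
    439, 441, 447, 518, 274, 442, 275, 383, 399, 407, 409, 434, 437, 255, 265, 299, 335, 363,
    435, 436, 446, 505, 252, 263, 396, 433, 438, 439, 441, 443, 262, 406, 440, 442, 447, 273,
    390, 399, 246, 255, 354, 363, 381, 505, 529, 252, 375, 376, 380, 383, 404, 222, 402, 438,
    95, 443, 272, 275, 495, 229, 409, 438, 442, 339, 267, 306, 309, 342, 345, 378, 381, 270,
    273, 440, 441, 447, 439, 272, 344, 406, 409, 426, 262, 334, 226, 406, 438, 442, 339, 267,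
    306, 309, 342, 345, 378, 381, 270, 273, 439, 441, 447, 440, 275, 347, 406, 426, 265, 337,
    27, 306, 309, 438, 88, 436, 262, 265, 488, 11, 290, 293, 426, 47, 340, 344, 347, 398, 401,
    426, 268, 272, 275, 307, 310, 219, 399, 438, 440, 441, 343, 379, 271, 439, 442, 447, 216,
    396, 438, 439, 441, 343, 346, 379, 382, 271, 274, 440, 442, 447, 64, 343, 346, 379, 382,
    271, 274, 439, 440, 442, 447, 441, 387, 390, 18, 15, 400, 429, 17, 428, 431, 201, 517, 270,
    342, 427, 445, 458, 506, 256, 430, 273, 345, 493, 270, 48, 312, 315, 243, 351, 360, 252,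
    289, 361, 397, 253, 427, 430, 445, 493, 378, 360, 252, 361, 362, 397, 254, 427, 445, 458,
    253, 430, 257, 345, 365, 407, 434, 435, 437, 446, 273, 299, 335, 381, 517, 263, 270, 342,
    427, 431, 433, 262, 334, 428, 430, 445, 255, 312, 318, 345, 246, 273, 354, 363, 381, 493,
    517, 270, 258, 330, 360, 363, 378, 381, 252, 255, 270, 273, 342, 345, 427, 428, 429, 430,
    431, 445, 438, 342, 345, 378, 381, 270, 273, 439, 440, 441, 447, 442, 391, 397, 400, 25,
    408, 26, 434, 202, 518, 271, 343, 427, 429, 430, 431, 445, 292, 49, 343, 518, 334, 364, 256,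
    262, 428, 255, 257, 363, 365, 433, 435, 437, 446, 343, 518, 334, 349, 364, 256, 262, 297,
    299, 333, 335, 405, 407, 428, 255, 257, 261, 263, 363, 365, 433, 435, 437, 446, 274, 494,
    271, 379, 433, 437, 446, 463, 487, 264, 435, 365, 382, 257, 274, 346, 362, 428, 429, 430,
    431, 445, 254, 289, 427, 252, 253, 503, 265, 349, 355, 382, 247, 274, 319, 337, 346, 494,
    518, 271, 332, 358, 362, 426, 260, 299, 302, 330, 334, 335, 337, 338, 407, 410, 258, 262,
    263, 265, 266, 297, 300, 433, 434, 437, 446, 435, 354, 360, 363, 378, 381, 64, 15, 429, 16,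
    428, 228, 535, 261, 333, 427, 430, 431, 445, 264, 336, 431, 487, 261, 405, 439, 441, 13,
    430, 445, 427, 252, 254, 527, 340, 346, 268, 310, 382, 442, 447, 274, 440, 273, 275, 492,
    336, 264, 408, 440, 441, 340, 343, 268, 307, 379, 442, 447, 271, 439, 270, 272, 491, 255,
    312, 318, 336, 246, 264, 390, 399, 408, 487, 535, 261, 394, 438, 250, 289, 292, 361, 364,
    396, 397, 399, 400, 405, 252, 253, 255, 256, 261, 333, 427, 428, 429, 430, 431, 445, 332,
    340, 344, 347, 260, 268, 272, 275, 299, 302, 307, 310, 330, 335, 338, 407, 410, 258, 263,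
    266, 297, 300, 437, 24, 434, 435, 446, 433, 262, 334, 379, 485, 261, 405, 438, 439, 440,
    441, 447, 343, 442, 271, 381, 64, 379, 382, 46, 334, 337, 262, 265, 433, 434, 446, 435, 378,
    153, 487, 264, 408, 440, 441, 442, 447, 439, 270, 271, 491, 261, 405, 439, 441, 442, 447,
    440, 273, 274, 492, 343, 346, 271, 274, 439, 440, 442, 447, 441, 273, 408, 493, 264, 270,
    378, 433, 435, 446, 486, 265, 438, 342, 345, 378, 408, 264, 270, 273, 382, 439, 440, 441,
    447, 442, 274, 494, 271, 379, 433, 435, 446, 486, 265, 267, 339, 358, 394, 426, 250, 330,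
    332, 334, 337, 258, 260, 262, 265, 297, 299, 300, 302, 335, 338, 405, 407, 408, 410, 436,
    263, 266, 433, 434, 437, 446, 435, 261, 264, 333, 336, 427, 428, 429, 430, 431, 445, 386,
    404, 242, 314, 394, 398, 401, 426, 290, 293, 330, 332, 334, 337, 358, 250, 260, 289, 292,
    299, 302, 361, 364, 402, 407, 410, 432, 258, 297, 300, 335, 338, 362, 365, 254, 257, 263,
    266, 431, 437, 25, 434, 436, 22, 433, 446, 435, 360, 363, 153, 333, 427, 429, 430, 445, 428,
    255, 256, 528, 261, 535, 264, 336, 428, 429, 430, 445, 427, 252, 253, 527, 262, 406, 397,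
    400, 253, 256, 360, 427, 428, 430, 445, 429, 252, 333, 529, 255, 363, 435, 446, 533, 261,
    265, 409, 397, 400, 253, 256, 363, 427, 428, 430, 445, 429, 255, 336, 529, 252, 360, 433,
    435, 436, 446, 534, 264]

lemma refute_refutation : refute code decode 240 clauseGroup refutation 0 [] = true := by
  decide +kernel

variable {c : PMCtx → Bool} {L D : Fin 4 → PMObs → Bool}

lemma exists_of_mem_sublistsLen (hc : (Finset.univ.filter fun K => c K = true).card = 3) :
    ∀ T ∈ allCtx.sublistsLen 4, ∃ K ∈ T, c K = true := by
  revert c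
  decide +kernel

lemma foldr_xor_eq_true (hc : (Finset.univ.filter fun K => c K = true).card = 3) :
    allCtx.foldr (fun K a => c K ^^ a) false = true := by
  revert c
  decide +kernel

lemma foldr_xor_xor {α : Type} (l : List α) (g g' : α → Bool) :
    l.foldr (fun i a => (g i ^^ g' i) ^^ a) false =
      (l.foldr (fun i a => g i ^^ a) false ^^ l.foldr (fun i a => g' i ^^ a) false) := by
  induction l with
  | nil => rfl
  | cons i l ih =>
    rw [List.foldr_cons, ih]
    rw [List.foldr_cons, List.foldr_cons, Bool.xor_assoc, Bool.xor_assoc, Bool.xor_left_comm (g' i)]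

lemma foldr_xor_ctxObs (d : PMObs → Bool) :
    allCtx.foldr (fun K a => (d (ctxObs K 0) ^^ d (ctxObs K 1) ^^ d (ctxObs K 2)) ^^ a) false =
      false := by
  revert d
  decide +kernel

lemma foldr_contra (s : Fin 4) :
    allCtx.foldr (fun K a => contra c D s K ^^ a) false =
      allCtx.foldr (fun K a => c K ^^ a) false := by
  refine (foldr_xor_xor allCtx c _).trans ?_
  rw [foldr_xor_ctxObs, Bool.xor_false]

lemma holds_targetClauses (h : LockSystem c L D) (s : Fin 4) (x : PMObs) :
    ∀ cl ∈ targetClauses s x, Holds (value c L D) cl := by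
  intro cl hcl
  rw [targetClauses, List.mem_singleton] at hcl
  subst hcl
  cases hx : L s x
  · obtain ⟨t, hts, ht⟩ := h.move s x hx
    exact ⟨(move s x t, true), by simp [hts], by simpa [value] using ht⟩
  · exact ⟨(lock s x, true), by simp, hx⟩

lemma holds_moveClauses (c : PMCtx → Bool) (L D : Fin 4 → PMObs → Bool) (s : Fin 4) (x : PMObs)
    (t : Fin 4) : ∀ cl ∈ moveClauses s x t, Holds (value c L D) cl := by
  intro cl hcl
  simp only [moveClauses, List.mem_flatMap, List.mem_filter, decide_eq_true_iff] at hcl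
  obtain ⟨y, ⟨-, hxy⟩, hcl⟩ := hcl
  by_cases hm : Moves L D s x t
  · by_cases hy : y = x ∨ L s y = true
    · obtain ⟨h1, h2⟩ := hm y hxy hy
      simp only [List.mem_cons, List.not_mem_nil, or_false] at hcl
      rcases hcl with rfl | rfl | rfl <;> refine holds_append.2 (Or.inr ?_) <;>
        cases hD : D s y <;> simp [Holds, value, h1, h2, hD]
    · rw [not_or, Bool.not_eq_true] at hy
      simp only [if_neg hy.1, List.mem_cons, List.not_mem_nil, or_false] at hcl
      rcases hcl with rfl | rfl | rfl <;> simp [Holds, value, hy.2]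
  · simp only [List.mem_cons, List.not_mem_nil, or_false] at hcl
    rcases hcl with rfl | rfl | rfl <;> simp [Holds, value, hm]

lemma holds_ctxClauses (h : LockSystem c L D) (h0 : ∀ x, D 0 x = false) (s : Fin 4) (K : PMCtx) :
    ∀ cl ∈ ctxClauses s K, Holds (value c L D) cl := by
  intro cl hcl
  rw [ctxClauses, List.mem_append, List.mem_map] at hcl
  rcases hcl with ⟨⟨p, q⟩, hpq, rfl⟩ | hcl
  · have hne : p ≠ q := by
      revert p q
      decide
    have := h.lock s K p q hne
    simp only [Holds, List.mem_cons, List.not_mem_nil, or_false, exists_eq_or_imp,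
      exists_eq_left, value]
    cases h1 : L s (ctxObs K p) <;> cases h2 : L s (ctxObs K q) <;> simp_all
  · refine holds_of_mem_xorClauses ?_ cl hcl
    simp only [List.foldr, value, contra, h0]
    cases c K <;> simp

lemma holds_parityClauses (L : Fin 4 → PMObs → Bool) (D : Fin 4 → PMObs → Bool)
    (hc : (Finset.univ.filter fun K => c K = true).card = 3) (s : Fin 4) :
    ∀ cl ∈ parityClauses s, Holds (value c L D) cl := by
  refine holds_of_mem_xorClauses ?_
  rw [List.foldr_map]
  exact (foldr_contra s).trans (foldr_xor_eq_true hc)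

lemma holds_transferClauses (h : LockSystem c L D) (s : Fin 4) (K : PMCtx) (t : Fin 4) :
    ∀ cl ∈ transferClauses s K t, Holds (value c L D) cl := by
  intro cl hcl
  simp only [transferClauses, List.mem_flatMap] at hcl
  obtain ⟨⟨p, q, r⟩, ho, a, ha, hcl⟩ := hcl
  obtain ⟨hpq, hpr, hqr⟩ : p ≠ q ∧ p ≠ r ∧ q ≠ r := by
    clear hcl ha
    revert p q r
    decide
  by_cases hyp : contra c D s K = true ∧ Moves L D s (ctxObs K p) t ∧ value c L D a = true
  · have hq : Moves L D s (ctxObs K q) t ∨ L s (ctxObs K q) = true := by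
      simp only [List.mem_cons, List.not_mem_nil, or_false] at ha
      rcases ha with rfl | rfl
      · exact Or.inl (by simpa [value] using hyp.2.2)
      · exact Or.inr hyp.2.2
    obtain ⟨h1, h2, h3, h4⟩ := h.two_transfers hpq hpr hqr hyp.1 hyp.2.1 hq
    simp only [List.mem_cons, List.not_mem_nil, or_false] at hcl
    rcases hcl with rfl | rfl | rfl | rfl | rfl
    · simp [Holds, value, h1]
    · simp [Holds, value, h3]
    · simp [Holds, value, h4]
    · cases hD : D s (ctxObs K r) <;> simp_all [Holds, value]
    · cases hD : D s (ctxObs K r) <;> simp_all [Holds, value]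
  · have key : Holds (value c L D)
        [(contradicted s K, false), (move s (ctxObs K p) t, false), (a, false)] := by
      simp only [Holds, List.mem_cons, List.not_mem_nil, or_false, exists_eq_or_imp,
        exists_eq_left]
      by_contra hcon
      simp only [not_or, Bool.not_eq_false] at hcon
      exact hyp ⟨hcon.1, by simpa [value] using hcon.2.1, hcon.2.2⟩
    obtain ⟨l, hl, hval⟩ := key
    refine ⟨l, ?_, hval⟩
    simp only [List.mem_cons, List.not_mem_nil, or_false] at hcl
    rcases hcl with rfl | rfl | rfl | rfl | rfl <;> exact List.mem_append_left _ hl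

lemma holds_initialClauses (h0 : ∀ x, D 0 x = false)
    (hc : (Finset.univ.filter fun K => c K = true).card = 3) (hK : c (0, 0) = true)
    (hx : L 0 (0, 0) = false) (hy : L 0 (0, 1) = false) (hxt : Moves L D 0 (0, 0) 1)
    (hyu : Moves L D 0 (0, 1) 2) : ∀ cl ∈ initialClauses, Holds (value c L D) cl := by
  have hc0 : ∀ K, contra c D 0 K = c K := fun K => by simp [contra, h0]
  intro cl hcl
  simp only [initialClauses, List.mem_append, List.mem_map] at hcl
  rcases hcl with (hcl | ⟨x, -, rfl⟩) | ⟨T, hT, rfl⟩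
  · simp only [List.mem_cons, List.not_mem_nil, or_false] at hcl
    rcases hcl with rfl | rfl | rfl | rfl | rfl <;> simp [Holds, value, *]
  · simp [Holds, value, h0]
  · obtain ⟨K, hKT, hcK⟩ := exists_of_mem_sublistsLen hc T hT
    exact ⟨(contradicted 0 K, true), List.mem_map_of_mem hKT, (hc0 K).trans hcK⟩

lemma LockSystem.false_of_moves (h : LockSystem c L D) (h0 : ∀ x, D 0 x = false)
    (hc : (Finset.univ.filter fun K => c K = true).card = 3) (hK : c (0, 0) = true)
    (hx : L 0 (0, 0) = false) (hy : L 0 (0, 1) = false) (hxt : Moves L D 0 (0, 0) 1)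
    (hyu : Moves L D 0 (0, 1) 2) : False := by
  refine not_maskFalse_of_refute (val := value c L D) code_injective (fun g => ?_)
    refute_refutation 0 List.mem_cons_self fun l hl => by simp at hl
  unfold clauseGroup
  split_ifs
  · exact holds_targetClauses h _ _
  · exact holds_moveClauses c L D _ _ _
  · exact holds_ctxClauses h h0 _ _
  · exact holds_parityClauses L D hc _
  · exact holds_transferClauses h _ _ _
  · exact holds_initialClauses h0 hc hK hx hy hxt hyu

end FourStates

/-- There is no automaton with exactly four internal states obeying both Q'_context and
Q'_compat in which some state contradicts exactly three of the six contexts. -/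
theorem pm_no_four_state_with_three_contradictions :
    ¬ ∃ (S : Type) (inst : Fintype S) (M : Mealy S PMObs),
        @Fintype.card S inst = 4 ∧ ObeysContext M ∧ ObeysCompat M ∧
        ∃ s : S, {K : PMCtx | Contradicted M s K}.ncard = 3 := by
  rintro ⟨S, inst, M, hS, hctx, hcompat, s, hcard⟩
  classical
  have hsys := lockSystem_of_obeys hctx hcompat s
  have hcard' : (Finset.univ.filter fun K => Contradicted M s K).card = 3 := by
    refine Eq.trans ?_ hcard
    rw [Set.ncard_eq_toFinset_card']
    congr 1
    ext
    simp
  obtain ⟨K, hK⟩ : (Finset.univ.filter fun K => Contradicted M s K).Nonempty := by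
    rw [← Finset.card_pos, hcard']
    decide
  rw [Finset.mem_filter] at hK
  obtain ⟨p, q, t, u, hpq, hp, hq, hts, hus, htu, ht, hu⟩ := hsys.exists_two_targets
    (s := s) (K := K) (by rw [contra_eq_contradicted]; simpa using hK.2)
  obtain ⟨σ, rfl, rfl, rfl⟩ := exists_equiv_fin_four hS hts hus htu
  obtain ⟨e, E, hE, he, hρ, hep, heq, hEK⟩ := exists_symmetry K p q hpq
  rw [← hep] at hp ht
  rw [← heq] at hq hu
  refine (hsys.relabel σ e E he hρ).false_of_moves (fun x => by simp) ?_ ?_ hp hq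
    (Moves.relabel he ht) (Moves.relabel he hu)
  · refine Eq.trans ?_ hcard'
    rw [← Finset.card_map (Equiv.ofBijective E hE).toEmbedding]
    congr 1
    ext K'
    obtain ⟨K', rfl⟩ := hE.2 K'
    simp
  · simpa [hEK] using hK.2
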